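/- Let ω be a finite sequence, k ≥ 1, let L_1, …, L_k be pairwise disjoint increasing subsequences of ω with total length |OPT|, and let A_1, …, A_k be a greedy execution with g_x = |A_1| + … + |A_x|. Then for every x with 1 ≤ x ≤ k, k·g_x ≥ (Σ_{i=0}^{x−1} ((k−1)/k)^i) · |OPT|. -/

import Mathlib

open Finset

section LIS

variable {ι : Type*} [DecidableEq ι] [Fintype ι] {α : Type*} [LinearOrder α]

/-- `A` is an increasing subsequence of the sequence `ω` restricted to the index
set `I`, where `r` is the precedence relation on indices: `A ⊆ I` and the values
of `ω` on `A` strictly increase along `r`. A subsequence is identified with its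
set of indices. -/
def IncSubseqOn (r : ι → ι → Prop) (ω : ι → α) (I A : Finset ι) : Prop :=
  A ⊆ I ∧ ∀ i ∈ A, ∀ j ∈ A, r i j → ω i < ω j

/-- `A` is a maximum-length increasing subsequence of `ω` restricted to `I`. -/
def IsMaxIncOn (r : ι → ι → Prop) (ω : ι → α) (I A : Finset ι) : Prop :=
  IncSubseqOn r ω I A ∧ ∀ B : Finset ι, IncSubseqOn r ω I B → B.card ≤ A.card

/-- `A 1, …, A k` is a greedy execution: each `A x` is a maximum-length increasing
subsequence of `ω` restricted to the indices outside `A 1 ∪ … ∪ A (x-1)`. -/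
def GreedyExec (r : ι → ι → Prop) (ω : ι → α) (k : ℕ) (A : ℕ → Finset ι) : Prop :=
  ∀ x, 1 ≤ x → x ≤ k →
    IsMaxIncOn r ω (Finset.univ \ (Finset.Icc 1 (x - 1)).biUnion A) (A x)

end LIS

/-- `k·g_x ≥ (Σ_{i=0}^{x-1} ((k-1)/k)^i)·|OPT|`. -/
theorem greedy_geometric_bound (n : ℕ) {α : Type*} [LinearOrder α] (ω : Fin n → α)
    (k : ℕ) (hk : 1 ≤ k)
    (L : ℕ → Finset (Fin n))
    (hL : ∀ i, 1 ≤ i → i ≤ k → IncSubseqOn (· < ·) ω Finset.univ (L i))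
    (hLdisj : ∀ i j, 1 ≤ i → i ≤ k → 1 ≤ j → j ≤ k → i ≠ j → Disjoint (L i) (L j))
    (A : ℕ → Finset (Fin n)) (hA : GreedyExec (· < ·) ω k A)
    (x : ℕ) (hx1 : 1 ≤ x) (hxk : x ≤ k) :
    (k : ℝ) * ∑ i ∈ Finset.Icc 1 x, ((A i).card : ℝ) ≥
      (∑ i ∈ Finset.range x, (((k : ℝ) - 1) / (k : ℝ)) ^ i) *
        ∑ i ∈ Finset.Icc 1 k, ((L i).card : ℝ) := by
  clear hx1
  have hk0 : (0 : ℝ) < k := by exact_mod_cast hk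
  have hk1 : (1 : ℝ) ≤ k := by exact_mod_cast hk
  induction x with
  | zero => simp
  | succ x ih =>
    have ih := ih (by omega)
    have hmax := hA (x + 1) (by omega) hxk
    simp only [Nat.add_sub_cancel] at hmax
    set U := (Finset.Icc 1 x).biUnion A with hU
    have h1 : ∀ i ∈ Finset.Icc 1 k, (L i \ U).card ≤ (A (x + 1)).card := by
      intro i hi
      rw [Finset.mem_Icc] at hi
      apply hmax.2
      refine ⟨Finset.sdiff_subset_sdiff (Finset.subset_univ _) (Finset.Subset.refl _), ?_⟩
      intro a ha b hb hab
      exact (hL i hi.1 hi.2).2 a (Finset.mem_sdiff.1 ha).1 b (Finset.mem_sdiff.1 hb).1 hab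
    have h2 : ∑ i ∈ Finset.Icc 1 k, (L i \ U).card ≤ k * (A (x + 1)).card := by
      have := Finset.sum_le_card_nsmul _ _ _ h1
      simpa using this
    have h3 : ∑ i ∈ Finset.Icc 1 k, (L i ∩ U).card ≤ U.card := by
      rw [← Finset.card_biUnion]
      · apply Finset.card_le_card
        intro a ha
        obtain ⟨i, _, hi⟩ := Finset.mem_biUnion.1 ha
        exact (Finset.mem_inter.1 hi).2
      · intro i hi j hj hij
        have hi := Finset.mem_Icc.1 hi
        have hj := Finset.mem_Icc.1 hj
        exact (hLdisj i j hi.1 hi.2 hj.1 hj.2 hij).mono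
          Finset.inter_subset_left Finset.inter_subset_left
    have h4 : U.card ≤ ∑ i ∈ Finset.Icc 1 x, (A i).card := Finset.card_biUnion_le
    have h5 : ∑ i ∈ Finset.Icc 1 k, (L i).card
        ≤ k * (A (x + 1)).card + ∑ i ∈ Finset.Icc 1 x, (A i).card := by
      have : ∑ i ∈ Finset.Icc 1 k, (L i).card
          = ∑ i ∈ Finset.Icc 1 k, (L i \ U).card + ∑ i ∈ Finset.Icc 1 k, (L i ∩ U).card := by
        rw [← Finset.sum_add_distrib]
        exact Finset.sum_congr rfl fun i _ => (Finset.card_sdiff_add_card_inter _ _).symm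
      omega
    have h6 : ∑ i ∈ Finset.Icc 1 k, ((L i).card : ℝ)
        ≤ k * ((A (x + 1)).card : ℝ) + ∑ i ∈ Finset.Icc 1 x, ((A i).card : ℝ) := by
      exact_mod_cast h5
    rw [geom_sum_succ, Finset.sum_Icc_succ_top (by omega)]
    generalize ∑ i ∈ Finset.Icc 1 k, ((L i).card : ℝ) = O at *
    generalize ∑ i ∈ Finset.Icc 1 x, ((A i).card : ℝ) = g at *
    generalize ∑ i ∈ Finset.range x, (((k : ℝ) - 1) / (k : ℝ)) ^ i = S at *
    have hq : 0 ≤ ((k : ℝ) - 1) / k := div_nonneg (by linarith) hk0.le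
    have h7 := mul_le_mul_of_nonneg_left ih hq
    have h8 : ((k : ℝ) - 1) / k * (k * g) = (k - 1) * g := by field_simp
    rw [h8] at h7
    linarith
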